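/- Let μ be a probability measure on a measurable space 𝒳, and let p(·|x), for x ∈ 𝒳, be a measurable family of continuously differentiable, strictly positive probability densities on ℝⁿ, each with finite Fisher information, such that the mixture density p_Y(y) = ∫ p(y|x) dμ(x) is continuously differentiable with ∇p_Y(y) = ∫ ∇_y p(y|x) dμ(x). Then J(p_Y) ≤ ∫ J(p(·|x)) dμ(x); equivalently, the mutual Fisher information J(X;Y) = J(Y|X) - J(Y) is nonnegative. -/

import Mathlib

open MeasureTheory Real

/-- Cauchy–Schwarz in quotient form: `‖∫ h‖² / ∫ p ≤ ∫ ‖h‖² / p` for positive `p`. -/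
theorem ofReal_norm_integral_sq_div_le_lintegral {α E : Type*} [MeasurableSpace α]
    [NormedAddCommGroup E] [NormedSpace ℝ E] (μ : Measure α) {h : α → E} {p : α → ℝ}
    (hm : AEStronglyMeasurable (fun x => ‖h x‖ ^ 2 / p x) μ) (hp : ∀ x, 0 < p x) :
    ENNReal.ofReal (‖∫ x, h x ∂μ‖ ^ 2 / ∫ x, p x ∂μ)
      ≤ ∫⁻ x, ENNReal.ofReal (‖h x‖ ^ 2 / p x) ∂μ := by
  have hnn : ∀ x, 0 ≤ ‖h x‖ ^ 2 / p x := fun x => div_nonneg (sq_nonneg _) (hp x).le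
  by_cases hh : Integrable h μ
  swap
  · simp [integral_undef hh]
  by_cases hpi : Integrable p μ
  swap
  · simp [integral_undef hpi]
  by_cases hq : Integrable (fun x => ‖h x‖ ^ 2 / p x) μ
  · rw [← ofReal_integral_eq_lintegral_ofReal hq (.of_forall hnn)]
    apply ENNReal.ofReal_le_ofReal
    rcases (integral_nonneg fun x => (hp x).le : 0 ≤ ∫ x, p x ∂μ).eq_or_lt with h0 | hP
    · rw [← h0, div_zero]
      exact integral_nonneg hnn
    set A := ‖∫ x, h x ∂μ‖
    set P := ∫ x, p x ∂μ
    have hA : A ≤ ∫ x, ‖h x‖ ∂μ := norm_integral_le_integral_norm h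
    have hc : 0 ≤ A / P := div_nonneg (norm_nonneg _) hP.le
    calc A ^ 2 / P = 2 * (A / P) * A - (A / P) ^ 2 * P := by field_simp; ring
      _ ≤ 2 * (A / P) * (∫ x, ‖h x‖ ∂μ) - (A / P) ^ 2 * P := by gcongr
      _ = ∫ x, (2 * (A / P) * ‖h x‖ - (A / P) ^ 2 * p x) ∂μ := by
        rw [integral_sub (hh.norm.const_mul _) (hpi.const_mul _), integral_const_mul,
          integral_const_mul]
      _ ≤ ∫ x, ‖h x‖ ^ 2 / p x ∂μ := by
        refine integral_mono ((hh.norm.const_mul _).sub (hpi.const_mul _)) hq fun x => ?_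
        have hpx := hp x
        simp only
        rw [le_div_iff₀ hpx]
        nlinarith [sq_nonneg (‖h x‖ - A / P * p x)]
  · have htop : ∫⁻ x, ENNReal.ofReal (‖h x‖ ^ 2 / p x) ∂μ = ⊤ := by
      by_contra hne
      exact hq ⟨hm, (hasFiniteIntegral_iff_ofReal (.of_forall hnn)).2 (lt_top_iff_ne_top.2 hne)⟩
    simp [htop]

/-- The gradient of a jointly measurable family of differentiable functions is jointly
measurable. -/
theorem measurable_gradient_uncurry {α ι : Type*} [MeasurableSpace α] [Fintype ι]
    {f : α → EuclideanSpace ℝ ι → ℝ} (hf : Measurable (Function.uncurry f))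
    (hd : ∀ x, Differentiable ℝ (f x)) :
    Measurable fun z : α × EuclideanSpace ℝ ι => gradient (f z.1) z.2 := by
  classical
  have hfderiv (v : EuclideanSpace ℝ ι) :
      Measurable fun z : α × EuclideanSpace ℝ ι => fderiv ℝ (f z.1) z.2 v := by
    refine measurable_of_tendsto_metrizable (f := fun (k : ℕ) z =>
      (k : ℝ) • (f z.1 (z.2 + (k : ℝ)⁻¹ • v) - f z.1 z.2)) (fun k => ?_)
      (tendsto_pi_nhds.2 fun z => ?_)
    · have h1 : Measurable fun z : α × EuclideanSpace ℝ ι => f z.1 (z.2 + (k : ℝ)⁻¹ • v) :=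
        hf.comp (measurable_fst.prodMk (measurable_snd.add_const _))
      exact (h1.sub hf).const_smul (k : ℝ)
    · refine (hd z.1 z.2).hasFDerivAt.lim v ?_
      exact tendsto_norm_atTop_atTop.comp tendsto_natCast_atTop_atTop
  have hcoord : Measurable fun z : α × EuclideanSpace ℝ ι => (gradient (f z.1) z.2).ofLp := by
    refine measurable_pi_iff.2 fun i => ?_
    convert hfderiv (EuclideanSpace.single i 1) using 2 with z
    rw [← inner_gradient_left, EuclideanSpace.inner_single_right]
    simp
  exact (WithLp.measurable_toLp 2 _).comp hcoord

/-- Fisher information of a mixture: if `p_Y(y) = ∫ p(y|x) dμ(x)` for a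
probability measure `μ` and a measurable family of continuously differentiable strictly
positive densities `p(·|x)` on `ℝⁿ`, each with finite Fisher information, and the mixture
is continuously differentiable with `∇p_Y(y) = ∫ ∇_y p(y|x) dμ(x)`, then
`J(p_Y) ≤ ∫ J(p(·|x)) dμ(x)`; equivalently, `J(X;Y) = J(Y|X) - J(Y) ≥ 0`. -/
theorem fisher_information_mixture_le
    {𝒳 : Type*} [MeasurableSpace 𝒳] (μ : Measure 𝒳) [IsProbabilityMeasure μ]
    (n : ℕ) (f : 𝒳 → EuclideanSpace ℝ (Fin n) → ℝ)
    (hmeas : Measurable (Function.uncurry f))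
    (hsmooth : ∀ x, ContDiff ℝ 1 (f x))
    (hpos : ∀ x y, 0 < f x y)
    (hprob : ∀ x, (∫ y, f x y) = 1)
    (hfin : ∀ x, Integrable (fun y => ‖gradient (f x) y‖ ^ 2 / f x y))
    (hfinavg : Integrable (fun x => ∫ y, ‖gradient (f x) y‖ ^ 2 / f x y) μ)
    (pY : EuclideanSpace ℝ (Fin n) → ℝ)
    (hpY : ∀ y, pY y = ∫ x, f x y ∂μ)
    (hpYsmooth : ContDiff ℝ 1 pY)
    (hgradswap : ∀ y, gradient pY y = ∫ x, gradient (f x) y ∂μ) :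
    (∫ y, ‖gradient pY y‖ ^ 2 / pY y)
      ≤ ∫ x, (∫ y, ‖gradient (f x) y‖ ^ 2 / f x y) ∂μ := by
  have hF : Measurable fun z : 𝒳 × EuclideanSpace ℝ (Fin n) =>
      ‖gradient (f z.1) z.2‖ ^ 2 / f z.1 z.2 :=
    ((measurable_gradient_uncurry hmeas fun x =>
      (hsmooth x).differentiable one_ne_zero).norm.pow_const 2).div hmeas
  have hnn : ∀ x y, 0 ≤ ‖gradient (f x) y‖ ^ 2 / f x y :=
    fun x y => div_nonneg (sq_nonneg _) (hpos x y).le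
  have hpYnn : ∀ y, 0 ≤ pY y := fun y => by
    rw [hpY]
    exact integral_nonneg fun x => (hpos x y).le
  have hgrad : Measurable (gradient pY) :=
    ((InnerProductSpace.toDual ℝ _).symm.continuous.comp
      (hpYsmooth.continuous_fderiv one_ne_zero)).measurable
  have hlhs : Measurable fun y => ‖gradient pY y‖ ^ 2 / pY y :=
    (hgrad.norm.pow_const 2).div hpYsmooth.continuous.measurable
  rw [integral_eq_lintegral_of_nonneg_ae
    (.of_forall fun y => div_nonneg (sq_nonneg _) (hpYnn y)) hlhs.aestronglyMeasurable]
  refine ENNReal.toReal_le_of_le_ofReal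
    (integral_nonneg fun x => integral_nonneg fun y => hnn x y) ?_
  calc ∫⁻ y, ENNReal.ofReal (‖gradient pY y‖ ^ 2 / pY y)
      ≤ ∫⁻ y, ∫⁻ x, ENNReal.ofReal (‖gradient (f x) y‖ ^ 2 / f x y) ∂μ := by
        refine lintegral_mono fun y => ?_
        simp only [hgradswap, hpY]
        exact ofReal_norm_integral_sq_div_le_lintegral μ
          (hF.comp measurable_prodMk_right).aestronglyMeasurable fun x => hpos x y
    _ = ∫⁻ x, (∫⁻ y, ENNReal.ofReal (‖gradient (f x) y‖ ^ 2 / f x y)) ∂μ :=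
        (lintegral_lintegral_swap hF.ennreal_ofReal.aemeasurable).symm
    _ = ∫⁻ x, ENNReal.ofReal (∫ y, ‖gradient (f x) y‖ ^ 2 / f x y) ∂μ :=
        lintegral_congr fun x =>
          (ofReal_integral_eq_lintegral_ofReal (hfin x) (.of_forall (hnn x))).symm
    _ = ENNReal.ofReal (∫ x, (∫ y, ‖gradient (f x) y‖ ^ 2 / f x y) ∂μ) :=
        (ofReal_integral_eq_lintegral_ofReal hfinavg
          (.of_forall fun x => integral_nonneg (hnn x))).symm
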